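/- arXiv:1810.10070 — 2 statements merged into one kernel-verified Lean document; each statement's English description precedes it below -/
import Mathlib

section
/- Let f ∈ H²(𝔹), f ≢ 0, and suppose p₁(q) = (q − λ)c (with λ, c ∈ ℍ, c ≠ 0) is the optimal approximant of degree 1 of f^{−*}. Then |λ| = ‖f * q‖²_{H²} / |⟨f, f * q⟩|, and in particular |λ| > 1. -/
open MeasureTheory Filter Topology
open scoped ENNReal Classical

noncomputable section

/-! ### Basic quaternionic notions -/

instance : MeasurableSpace (Quaternion ℝ) := borel _
instance : BorelSpace (Quaternion ℝ) := ⟨rfl⟩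

/-- The 2-sphere `𝕊` of quaternionic imaginary units. -/
def USphere : Set (Quaternion ℝ) := {q | q ^ 2 = -1}

/-- The open quaternionic unit ball `𝔹`. -/
def QBall : Set (Quaternion ℝ) := {q | ‖q‖ < 1}

/-- The slice `L_I = ℝ + ℝI` through an imaginary unit `I`. -/
def sliceSet (I : Quaternion ℝ) : Set (Quaternion ℝ) :=
  {q | ∃ x y : ℝ, q = (x : Quaternion ℝ) + y • I}

/-- The point `e^{tI} = cos t + (sin t) I` of the boundary circle `∂𝔹_I`. -/
def ptOn (I : Quaternion ℝ) (t : ℝ) : Quaternion ℝ :=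
  ((Real.cos t : ℝ) : Quaternion ℝ) + Real.sin t • I

/-- Slice regularity on the unit ball: on every slice the restriction of `f` has partial
derivatives satisfying the Cauchy–Riemann equation `∂f/∂x + I ∂f/∂y = 0`. -/
def SliceRegular (f : Quaternion ℝ → Quaternion ℝ) : Prop :=
  ∀ I ∈ USphere, ∀ x y : ℝ, ((x : Quaternion ℝ) + y • I) ∈ QBall →
    ∃ fx fy : Quaternion ℝ,
      HasDerivAt (fun s : ℝ => f ((s : Quaternion ℝ) + y • I)) fx x ∧
      HasDerivAt (fun t : ℝ => f ((x : Quaternion ℝ) + t • I)) fy y ∧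
      fx + I * fy = 0

/-! ### The Hardy space `H²(𝔹)` via power series coefficients.
A slice regular function on `𝔹` is identified with its coefficient sequence
`a : ℕ → ℍ`, the function being `q ↦ ∑ qⁿ aₙ`. -/

/-- Membership in `H²(𝔹)`: square-summable coefficients. -/
def MemH2 (a : ℕ → Quaternion ℝ) : Prop := Summable (fun n => ‖a n‖ ^ 2)

/-- Evaluation of the power series `q ↦ ∑ qⁿ aₙ`. -/
def evalS (a : ℕ → Quaternion ℝ) (q : Quaternion ℝ) : Quaternion ℝ := ∑' n, q ^ n * a n

/-- The `*`-product (slice product) on coefficient sequences. -/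
def sProd (a b : ℕ → Quaternion ℝ) : ℕ → Quaternion ℝ :=
  fun n => ∑ k ∈ Finset.range (n + 1), a k * b (n - k)

/-- The regular conjugate `fᶜ`. -/
def conjS (a : ℕ → Quaternion ℝ) : ℕ → Quaternion ℝ := fun n => star (a n)

/-- The symmetrization `fˢ = f * fᶜ`. -/
def symmS (a : ℕ → Quaternion ℝ) : ℕ → Quaternion ℝ := sProd a (conjS a)

/-- The squared `H²` norm `∑ ‖aₙ‖²`. -/
def h2normSq (a : ℕ → Quaternion ℝ) : ℝ := ∑' n, ‖a n‖ ^ 2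

/-- The `H²` norm. -/
def h2norm (a : ℕ → Quaternion ℝ) : ℝ := Real.sqrt (h2normSq a)

/-- The (right) quaternionic inner product `⟨f,g⟩ = ∑ conj(bₙ) aₙ` of `H²(𝔹)`. -/
def h2inner (a b : ℕ → Quaternion ℝ) : Quaternion ℝ := ∑' n, star (b n) * a n

/-- Squared `H²`-distance of two coefficient sequences (valued in `ℝ≥0∞`). -/
def h2distSq (a b : ℕ → Quaternion ℝ) : ℝ≥0∞ := ∑' n, (‖a n - b n‖₊ : ℝ≥0∞) ^ 2

/-- The boundary value function of `f ∈ H²(𝔹)`, given by the radial limit where it exists. -/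
def bdval (a : ℕ → Quaternion ℝ) (q : Quaternion ℝ) : Quaternion ℝ :=
  if h : ∃ L, Tendsto (fun r : ℝ => evalS a ((r : Quaternion ℝ) * q)) (𝓝[<] (1 : ℝ)) (𝓝 L)
  then h.choose else 0

/-! ### The measure `Σ` on `∂𝔹` with `dΣ(e^{tI}) = dσ(I) dt`. -/

/-- The normalized area measure `σ` on the sphere `𝕊` of imaginary units
(2-dimensional Hausdorff measure, normalized so that `σ(𝕊) = 1`). -/
def sphMeasure : Measure (Quaternion ℝ) := (μH[2] USphere)⁻¹ • (μH[2]).restrict USphere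

/-- The measure `Σ` on `∂𝔹`, `dΣ(e^{tI}) = dσ(I) dt`, normalized so `Σ(∂𝔹) = 1`. -/
def SigmaBd : Measure (Quaternion ℝ) :=
  (ENNReal.ofReal (2 * Real.pi))⁻¹ •
    Measure.map (fun p : ℝ × Quaternion ℝ => ptOn p.2 p.1)
      ((volume.restrict (Set.Ico 0 (2 * Real.pi))).prod sphMeasure)

/-! ### Inner, outer, cyclic -/

/-- `f ∈ H^∞(𝔹)`: a bounded function of `H²(𝔹)`. -/
def MemHinf (a : ℕ → Quaternion ℝ) : Prop :=
  MemH2 a ∧ ∃ C : ℝ, ∀ q ∈ QBall, ‖evalS a q‖ ≤ C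

/-- The `H^∞` norm: the sup of `‖f‖` on the ball. -/
def hInfNorm (a : ℕ → Quaternion ℝ) : ℝ := sSup ((fun q => ‖evalS a q‖) '' QBall)

/-- `f` is inner: `f ∈ H^∞(𝔹)`, `‖f‖ ≤ 1` on `𝔹` and `‖f‖ = 1` `Σ`-a.e. on `∂𝔹`. -/
def IsInnerQ (a : ℕ → Quaternion ℝ) : Prop :=
  MemH2 a ∧ (∀ q ∈ QBall, ‖evalS a q‖ ≤ 1) ∧ (∀ᵐ q ∂SigmaBd, ‖bdval a q‖ = 1)

/-- `g` is outer: whenever `f ∈ H²(𝔹)` has the same boundary modulus `Σ`-a.e.,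
then `‖g‖ ≥ ‖f‖` throughout `𝔹`. -/
def IsOuterQ (g : ℕ → Quaternion ℝ) : Prop :=
  MemH2 g ∧ ∀ f, MemH2 f → (∀ᵐ q ∂SigmaBd, ‖bdval g q‖ = ‖bdval f q‖) →
    ∀ q ∈ QBall, ‖evalS f q‖ ≤ ‖evalS g q‖

/-- Quaternionic polynomials (finitely supported coefficient sequences). -/
def IsPolyQ (p : ℕ → Quaternion ℝ) : Prop := ∃ N, ∀ n > N, p n = 0

/-- Quaternionic polynomials of degree at most `n` (the space `𝒫_n`). -/
def IsPolyDeg (p : ℕ → Quaternion ℝ) (n : ℕ) : Prop := ∀ m > n, p m = 0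

/-- The coefficient sequence of the monomial `qᵏ`. -/
def qpow (k : ℕ) : ℕ → Quaternion ℝ := fun n => if n = k then 1 else 0

/-- The coefficient sequence of a constant function. -/
def constS (c : Quaternion ℝ) : ℕ → Quaternion ℝ := fun n => if n = 0 then c else 0

/-- The coefficient sequence of the constant function `1`. -/
def oneS : ℕ → Quaternion ℝ := constS 1

/-- The invariant subspace `[g]`: the `H²`-closure of `{g * p : p polynomial}`,
i.e. of the right span of `{qⁿ * g : n ≥ 0}`. -/
def InvSub (g : ℕ → Quaternion ℝ) : Set (ℕ → Quaternion ℝ) :=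
  {h | MemH2 h ∧ ∀ ε : ℝ≥0∞, 0 < ε → ∃ p, IsPolyQ p ∧ h2distSq (sProd g p) h < ε}

/-- `g` is cyclic: `[g] = H²(𝔹)`. -/
def IsCyclicQ (g : ℕ → Quaternion ℝ) : Prop :=
  MemH2 g ∧ ∀ h, MemH2 h → h ∈ InvSub g

/-! ### Bilateral (slice `L²`) series, used for boundary products -/

/-- Bilateral coefficients of `f̃(q) = f(q̄)` on `∂𝔹`: `Σ_{n ≤ 0} qⁿ a_{-n}`. -/
def tildeZ (a : ℕ → Quaternion ℝ) : ℤ → Quaternion ℝ :=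
  fun k => if k ≤ 0 then a (-k).toNat else 0

/-- Bilateral coefficients of `fᶜ` on `∂𝔹`. -/
def conjZ (a : ℕ → Quaternion ℝ) : ℤ → Quaternion ℝ :=
  fun k => if 0 ≤ k then star (a k.toNat) else 0

/-- The `*`-product of two slice `L²` functions on the boundary, on coefficients. -/
def convZ (c b : ℤ → Quaternion ℝ) : ℤ → Quaternion ℝ := fun n => ∑' k : ℤ, c k * b (n - k)

/-- Evaluation of a bilateral series `q ↦ ∑_{n ∈ ℤ} qⁿ dₙ`. -/
def evalZ (d : ℤ → Quaternion ℝ) (q : Quaternion ℝ) : Quaternion ℝ := ∑' n : ℤ, q ^ n * d n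

/-- The slice inner product `⟨qᵏ * f, f⟩_I = (1/2π)∫₀^{2π} conj(f(e^{θI})) (e^{θI})ᵏ f(e^{θI}) dθ`,
computed with boundary values; note `(qᵏ * f)(q) = qᵏ f(q)` pointwise. -/
def sliceInnerPow (a : ℕ → Quaternion ℝ) (I : Quaternion ℝ) (k : ℕ) : Quaternion ℝ :=
  (2 * Real.pi)⁻¹ •
    ∫ t in Set.Ico 0 (2 * Real.pi), star (bdval a (ptOn I t)) * ((ptOn I t) ^ k * bdval a (ptOn I t))

/-! ### Complex Hardy space `H²(𝔻)` notions (for slice restrictions) -/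

/-- Membership in the complex Hardy space `H²(𝔻)` via coefficients. -/
def CMemH2 (c : ℕ → ℂ) : Prop := Summable (fun n => ‖c n‖ ^ 2)

/-- Evaluation of a complex power series. -/
def cEval (c : ℕ → ℂ) (z : ℂ) : ℂ := ∑' n, z ^ n * c n

/-- Cauchy product of complex coefficient sequences. -/
def cConv (c d : ℕ → ℂ) : ℕ → ℂ := fun n => ∑ k ∈ Finset.range (n + 1), c k * d (n - k)

/-- Squared `H²(𝔻)` distance. -/
def cDistSq (c d : ℕ → ℂ) : ℝ≥0∞ := ∑' n, (‖c n - d n‖₊ : ℝ≥0∞) ^ 2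

/-- Radial boundary values of a complex `H²` function. -/
def cBdval (c : ℕ → ℂ) (z : ℂ) : ℂ :=
  if h : ∃ L, Tendsto (fun r : ℝ => cEval c ((r : ℂ) * z)) (𝓝[<] (1 : ℝ)) (𝓝 L)
  then h.choose else 0

/-- Lebesgue measure on the unit circle `∂𝔻` (parametrized by `θ ∈ [0, 2π)`). -/
def circleM : Measure ℂ :=
  Measure.map (fun t : ℝ => Complex.exp (t * Complex.I)) (volume.restrict (Set.Ico 0 (2 * Real.pi)))

/-- Cyclicity in `H²(𝔻)`: polynomial multiples of `c` are dense. -/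
def CIsCyclic (c : ℕ → ℂ) : Prop :=
  CMemH2 c ∧ ∀ h, CMemH2 h → ∀ ε : ℝ≥0∞, 0 < ε →
    ∃ p : ℕ → ℂ, (∃ N, ∀ n > N, p n = 0) ∧ cDistSq (cConv c p) h < ε

/-- Outerness in `H²(𝔻)` (in the sense matching Definition 2.10 of the paper). -/
def CIsOuter (c : ℕ → ℂ) : Prop :=
  CMemH2 c ∧ ∀ h, CMemH2 h →
    (∀ᵐ z ∂circleM, ‖cBdval c z‖ = ‖cBdval h z‖) →
    ∀ z ∈ Metric.ball (0 : ℂ) 1, ‖cEval h z‖ ≤ ‖cEval c z‖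

/-- Complex coordinates of a point of the slice `L_I`: if `p = x + yI` then
`sliceToC I p = x + iy`. -/
def sliceToC (I : Quaternion ℝ) (p : Quaternion ℝ) : ℂ := ⟨p.re, -(p * I).re⟩

/-- The quaternion `i`. -/
def qI : Quaternion ℝ := ⟨0, 1, 0, 0⟩

/-- The embedding of `ℂ = L_i` into the quaternions. -/
def cToQ (z : ℂ) : Quaternion ℝ := (z.re : Quaternion ℝ) + z.im • qI

/-- The imaginary unit `I_ω` identified by `ω` (any imaginary unit if `ω` is real). -/
def Iu (ω : Quaternion ℝ) : Quaternion ℝ := if ω.im = 0 then qI else ‖ω.im‖⁻¹ • ω.im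

/-! ### Optimal approximants -/

/-- `p` is an optimal approximant of degree `n` of `f^{-*}`: `p ∈ 𝒫_n` minimizes
`‖f * p - 1‖_{H²}` among all `p ∈ 𝒫_n`. -/
def IsOptApprox (a : ℕ → Quaternion ℝ) (n : ℕ) (p : ℕ → Quaternion ℝ) : Prop :=
  IsPolyDeg p n ∧ ∀ r, IsPolyDeg r n → h2distSq (sProd a p) oneS ≤ h2distSq (sProd a r) oneS

end

/-- The linear polynomial `x + q y`. -/
noncomputable def linS (x y : Quaternion ℝ) : ℕ → Quaternion ℝ :=
  fun n => if n = 0 then x else if n = 1 then y else 0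

/-- The shifted sequence. -/
noncomputable def shS (a : ℕ → Quaternion ℝ) : ℕ → Quaternion ℝ
  | 0 => 0
  | n + 1 => a n

theorem sProd_linS (a : ℕ → Quaternion ℝ) (x y : Quaternion ℝ) (n : ℕ) :
    sProd a (linS x y) n = a n * x + shS a n * y := by
  cases n with
  | zero => simp [sProd, linS, shS]
  | succ n =>
    unfold sProd
    rw [Finset.sum_range_succ, Finset.sum_range_succ, Finset.sum_eq_zero]
    · simp [linS, shS, add_comm]
    · intro k hk
      have hk' := Finset.mem_range.1 hk
      have h0 : n + 1 - k ≠ 0 := by omega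
      have h1 : n + 1 - k ≠ 1 := by omega
      simp [linS, h0, h1]

theorem qpow_one_eq : qpow 1 = linS 0 1 := by
  funext n
  unfold qpow linS
  by_cases h : n = 0
  · subst h; simp
  · simp [h]

theorem sProd_qpow_one (a : ℕ → Quaternion ℝ) : sProd a (qpow 1) = shS a := by
  funext n
  rw [qpow_one_eq, sProd_linS]; simp

theorem memH2_shS {a : ℕ → Quaternion ℝ} (ha : MemH2 a) : MemH2 (shS a) := by
  unfold MemH2
  rw [← summable_nat_add_iff 1]
  exact ha

theorem h2normSq_shS {a : ℕ → Quaternion ℝ} (ha : MemH2 a) : h2normSq (shS a) = h2normSq a := by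
  unfold h2normSq
  rw [(memH2_shS ha).tsum_eq_zero_add]
  simp [shS]

theorem memH2_add {a b : ℕ → Quaternion ℝ} (ha : MemH2 a) (hb : MemH2 b) :
    MemH2 (fun n => a n + b n) := by
  refine Summable.of_nonneg_of_le (fun n => by positivity) (fun n => ?_)
    ((ha.add hb).mul_left 2)
  have h := norm_add_le (a n) (b n)
  have h0 := norm_nonneg (a n + b n)
  nlinarith [sq_nonneg (‖a n‖ - ‖b n‖)]

theorem memH2_mul {a : ℕ → Quaternion ℝ} (ha : MemH2 a) (x : Quaternion ℝ) :
    MemH2 (fun n => a n * x) := by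
  unfold MemH2
  simp only [norm_mul, mul_pow]
  exact ha.mul_right _

theorem memH2_oneS (x : Quaternion ℝ) : MemH2 (constS x) := by
  refine summable_of_ne_finset_zero (s := {0}) (fun n hn => ?_)
  have : n ≠ 0 := by simpa using hn
  simp [constS, this]

theorem summable_norm_inner {a b : ℕ → Quaternion ℝ} (ha : MemH2 a) (hb : MemH2 b) :
    Summable (fun n => ‖star (b n) * a n‖) := by
  refine Summable.of_nonneg_of_le (fun n => by positivity) (fun n => ?_) (ha.add hb)
  rw [norm_mul, norm_star]
  nlinarith [sq_nonneg (‖a n‖ - ‖b n‖), sq_nonneg (‖a n‖), sq_nonneg ‖b n‖]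

theorem summable_inner {a b : ℕ → Quaternion ℝ} (ha : MemH2 a) (hb : MemH2 b) :
    Summable (fun n => star (b n) * a n) := (summable_norm_inner ha hb).of_norm

theorem h2distSq_eq {a b : ℕ → Quaternion ℝ} (h : MemH2 (fun n => a n - b n)) :
    h2distSq a b = ENNReal.ofReal (h2normSq (fun n => a n - b n)) := by
  unfold h2distSq h2normSq
  rw [ENNReal.ofReal_tsum_of_nonneg (fun n => by positivity) h]
  congr 1
  funext n
  rw [ENNReal.ofReal_pow (norm_nonneg _), ofReal_norm, enorm_eq_nnnorm]

theorem expand_norm (u s e : Quaternion ℝ) (t : ℝ) :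
    ‖u + s * (t • e)‖ ^ 2 = ‖u‖ ^ 2 + 2 * t * (star e * (star s * u)).re
      + t ^ 2 * ‖e‖ ^ 2 * ‖s‖ ^ 2 := by
  have key : ∀ q : Quaternion ℝ, ‖q‖ ^ 2 = Quaternion.normSq q := fun q => by
    rw [Quaternion.normSq_eq_norm_mul_self, sq]
  simp only [key, Quaternion.normSq_def', Quaternion.re_mul, Quaternion.imI_mul,
    Quaternion.imJ_mul, Quaternion.imK_mul, Quaternion.re_star, Quaternion.imI_star,
    Quaternion.imJ_star, Quaternion.imK_star, Quaternion.re_add, Quaternion.imI_add,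
    Quaternion.imJ_add, Quaternion.imK_add, Quaternion.re_smul, Quaternion.imI_smul,
    Quaternion.imJ_smul, Quaternion.imK_smul, smul_eq_mul]
  ring

theorem h2normSq_pert {u s : ℕ → Quaternion ℝ} (hu : MemH2 u) (hs : MemH2 s) (t : ℝ) :
    h2normSq (fun n => u n + s n * (t • h2inner u s)) =
      h2normSq u + 2 * t * ‖h2inner u s‖ ^ 2 + t ^ 2 * ‖h2inner u s‖ ^ 2 * h2normSq s := by
  have hin : HasSum (fun n => star (s n) * u n) (h2inner u s) := (summable_inner hu hs).hasSum
  generalize h2inner u s = e at *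
  have h1 := hin.mul_left (star e)
  have h2 : HasSum (fun n => (star e * (star (s n) * u n)).re) (star e * e).re := by
    exact h1.map (⟨⟨fun q : Quaternion ℝ => q.re, rfl⟩, fun _ _ => rfl⟩ : Quaternion ℝ →+ ℝ)
      Quaternion.continuous_re
  have h3 : (star e * e).re = ‖e‖ ^ 2 := by
    rw [Quaternion.star_mul_self, Quaternion.re_coe, Quaternion.normSq_eq_norm_mul_self, sq]
  rw [h3] at h2
  have hu' : HasSum (fun n => ‖u n‖ ^ 2) (h2normSq u) := hu.hasSum
  have hs' : HasSum (fun n => ‖s n‖ ^ 2) (h2normSq s) := hs.hasSum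
  have h4 := (hu'.add (h2.mul_left (2 * t))).add (hs'.mul_left (t ^ 2 * ‖e‖ ^ 2))
  rw [← h4.tsum_eq]
  unfold h2normSq
  simp only [expand_norm]

theorem inner_eq_zero_of_min {u s : ℕ → Quaternion ℝ} (hu : MemH2 u) (hs : MemH2 s)
    (hN : 0 < h2normSq s)
    (hmin : ∀ d : Quaternion ℝ, h2normSq u ≤ h2normSq (fun n => u n + s n * d)) :
    h2inner u s = 0 := by
  have h := hmin ((-(h2normSq s)⁻¹ : ℝ) • h2inner u s)
  rw [h2normSq_pert hu hs] at h
  have hi : 0 < (h2normSq s)⁻¹ := inv_pos.2 hN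
  have h5 : (-(h2normSq s)⁻¹) ^ 2 * ‖h2inner u s‖ ^ 2 * h2normSq s
      = (h2normSq s)⁻¹ * ‖h2inner u s‖ ^ 2 := by
    field_simp
  rw [h5] at h
  have h6 : (h2normSq s)⁻¹ * ‖h2inner u s‖ ^ 2 ≤ 0 := by linarith
  have h7 : ‖h2inner u s‖ ^ 2 ≤ 0 := by
    by_contra hcon
    push Not at hcon
    nlinarith [mul_pos hi hcon]
  have h8 : ‖h2inner u s‖ = 0 := by nlinarith [norm_nonneg (h2inner u s)]
  exact norm_eq_zero.1 h8

theorem h2normSq_pos {a : ℕ → Quaternion ℝ} (ha : MemH2 a) (hne : a ≠ 0) : 0 < h2normSq a := by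
  obtain ⟨n, hn⟩ := Function.ne_iff.1 hne
  have hn' : a n ≠ 0 := hn
  exact ha.tsum_pos (fun n => by positivity) n (by positivity)

theorem inner_lt {a : ℕ → Quaternion ℝ} (ha : MemH2 a) (hne : a ≠ 0) :
    ‖h2inner a (shS a)‖ < h2normSq a := by
  have hs := memH2_shS ha
  have hsum := summable_norm_inner ha hs
  have h1 : ‖h2inner a (shS a)‖ ≤ ∑' n, ‖star (shS a n) * a n‖ := norm_tsum_le_tsum_norm hsum
  have hex : ∃ n, ‖shS a n‖ ≠ ‖a n‖ := by
    by_contra hcon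
    push Not at hcon
    apply hne
    funext n
    induction n with
    | zero => have := hcon 0; simpa [shS, eq_comm] using this
    | succ n ih => have := hcon (n + 1); simpa [shS, ih, eq_comm] using this
  obtain ⟨m, hm⟩ := hex
  have h2 : ∑' n, ‖star (shS a n) * a n‖ < ∑' n, (1 / 2) * (‖a n‖ ^ 2 + ‖shS a n‖ ^ 2) := by
    refine Summable.tsum_lt_tsum (i := m) (fun n => ?_) ?_ hsum ((ha.add hs).mul_left _)
    · rw [norm_mul, norm_star]
      nlinarith [sq_nonneg (‖a n‖ - ‖shS a n‖)]
    · rw [norm_mul, norm_star]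
      have := sq_pos_of_ne_zero (sub_ne_zero.2 hm)
      nlinarith
  have h3 : ∑' n, (1 / 2) * (‖a n‖ ^ 2 + ‖shS a n‖ ^ 2) = h2normSq a := by
    rw [tsum_mul_left, Summable.tsum_add ha hs]
    have := h2normSq_shS ha
    unfold h2normSq at this ⊢
    rw [this]; ring
  linarith

/-- If `f ∈ H²(𝔹)`, `f ≢ 0`, and `p₁(q) = (q - λ)c` (with `c ≠ 0`) is the optimal
approximant of degree 1 of `f^{-*}`, then `|λ| = ‖f * q‖²_{H²} / |⟨f, f * q⟩|`, and in
particular `|λ| > 1`. -/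
theorem degree_one_opt_approx_zero (a : ℕ → Quaternion ℝ) (ha : MemH2 a) (hne : a ≠ 0)
    (l c : Quaternion ℝ) (hc : c ≠ 0)
    (hp : IsOptApprox a 1
      (fun n => if n = 0 then -(l * c) else if n = 1 then c else 0)) :
    ‖l‖ = h2normSq (sProd a (qpow 1)) / ‖h2inner a (sProd a (qpow 1))‖ ∧ 1 < ‖l‖ := by
  have hs := memH2_shS ha
  have hN : 0 < h2normSq (shS a) := by rw [h2normSq_shS ha]; exact h2normSq_pos ha hne
  rw [sProd_qpow_one]
  have hmem : ∀ x y : Quaternion ℝ, MemH2 (fun n => sProd a (linS x y) n - oneS n) := by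
    intro x y
    have h := memH2_add (memH2_add (memH2_mul ha x) (memH2_mul hs y)) (memH2_oneS (-1))
    convert h using 2 with n
    rw [sProd_linS, sub_eq_add_neg]
    congr 1
    unfold oneS constS
    split_ifs <;> simp
  have hu := hmem (-(l * c)) c
  have hmin : ∀ d : Quaternion ℝ, h2normSq (fun n => sProd a (linS (-(l * c)) c) n - oneS n) ≤
      h2normSq (fun n => (sProd a (linS (-(l * c)) c) n - oneS n) + shS a n * d) := by
    intro d
    have h := hp.2 (linS (-(l * c)) (c + d)) (by
      intro m hm
      have h0 : m ≠ 0 := by omega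
      have h1 : m ≠ 1 := by omega
      simp [linS, h0, h1])
    change h2distSq (sProd a (linS (-(l * c)) c)) oneS ≤ _ at h
    rw [h2distSq_eq (hmem _ _), h2distSq_eq (hmem _ _), ENNReal.ofReal_le_ofReal_iff
      (show 0 ≤ h2normSq _ from tsum_nonneg fun n => by positivity)] at h
    convert h using 3 with n
    simp only [sProd_linS, mul_add]
    abel
  have horth := inner_eq_zero_of_min hu hs hN hmin
  have hA : HasSum (fun n => star (shS a n) * a n) (h2inner a (shS a)) :=
    (summable_inner ha hs).hasSum
  have hS : HasSum (fun n => star (shS a n) * shS a n)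
      ((h2normSq (shS a) : ℝ) : Quaternion ℝ) := by
    have h : HasSum (fun n => ‖shS a n‖ ^ 2) (h2normSq (shS a)) := hs.hasSum
    have h' := Quaternion.hasSum_coe.2 h
    convert h' using 2 with n
    rw [Quaternion.star_mul_self, Quaternion.normSq_eq_norm_mul_self, sq]
  have hU := (hA.mul_right (-(l * c))).add (hS.mul_right c)
  have heq : h2inner a (shS a) * (-(l * c)) + ((h2normSq (shS a) : ℝ) : Quaternion ℝ) * c = 0 := by
    rw [← hU.tsum_eq, ← horth]
    unfold h2inner
    congr 1
    funext n
    beta_reduce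
    rw [sProd_linS]
    cases n with
    | zero => simp [shS]
    | succ n => simp [oneS, constS, mul_add, mul_assoc]
  have heq2 : ((h2normSq (shS a) : ℝ) : Quaternion ℝ) = h2inner a (shS a) * l := by
    apply mul_right_cancel₀ hc
    rw [mul_neg, ← mul_assoc] at heq
    rw [← sub_eq_zero, sub_eq_add_neg, add_comm]
    exact heq
  have hnorm : h2normSq (shS a) = ‖h2inner a (shS a)‖ * ‖l‖ := by
    have := congrArg norm heq2
    rwa [norm_mul, Quaternion.norm_coe, Real.norm_of_nonneg hN.le] at this
  have hlt := inner_lt ha hne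
  rw [← h2normSq_shS ha] at hlt
  have hpos : 0 < ‖h2inner a (shS a)‖ := by
    rcases (norm_nonneg (h2inner a (shS a))).lt_or_eq with h | h
    · exact h
    · rw [← h, zero_mul] at hnorm; linarith
  refine ⟨by rw [eq_div_iff hpos.ne', hnorm]; ring, ?_⟩
  by_contra hcon
  push Not at hcon
  nlinarith [mul_le_mul_of_nonneg_left hcon hpos.le]
end

section
/- Let f ∈ H²(𝔹) with f(0) ≠ 0, let p_n be the optimal approximant of degree n of f^{−*} for each n ∈ ℕ, and let {f * φ_k}_{k≥0} be an orthonormal system where for each n the family {f * φ_k}_{k=0}^n is an orthonormal basis of f * 𝒫_n with deg φ_k = k. Then the following are equivalent: (i) f is cyclic in H²(𝔹); (ii) p_n(0) converges to f^{−*}(0) as n → ∞; (iii) Σ_{k=0}^∞ |φ_k(0)|² = |f^{−*}(0)|². -/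
open MeasureTheory Filter Topology
open scoped ENNReal Classical

lemma evalS_zero' (a : ℕ → Quaternion ℝ) : evalS a 0 = a 0 := by
  unfold evalS
  rw [tsum_eq_single 0]
  · simp
  · intro n hn; simp [hn]

lemma target_eq (a : ℕ → Quaternion ℝ) :
    (evalS (symmS a) 0)⁻¹ * evalS (conjS a) 0 = (a 0)⁻¹ := by
  rw [evalS_zero', evalS_zero']
  simp only [symmS, sProd, conjS]
  by_cases h : a 0 = 0
  · simp [h]
  · have h' : star (a 0) ≠ 0 := by simpa using h
    simp [mul_inv_rev, mul_assoc]
    rw [← mul_assoc]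
    have := Quaternion.self_mul_star (a 0)
    have h2 := Quaternion.star_mul_self (a 0)
    have h3 : ((star (a 0))⁻¹ * (a 0)⁻¹ ) * star (a 0)= (a 0)⁻¹ := by
      rw [← mul_inv_rev, this, ← h2, mul_inv_rev, mul_assoc, inv_mul_cancel₀ h', mul_one]
    simpa [mul_assoc] using h3

lemma sProd_assoc (a b c : ℕ → Quaternion ℝ) :
    sProd (sProd a b) c = sProd a (sProd b c) := by
  have key : ∀ x y : ℕ → Quaternion ℝ,
      PowerSeries.mk (sProd x y) = PowerSeries.mk x * PowerSeries.mk y := by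
    intro x y
    ext n : 1
    rw [PowerSeries.coeff_mul, PowerSeries.coeff_mk]
    simp only [PowerSeries.coeff_mk, sProd]
    rw [Finset.Nat.sum_antidiagonal_eq_sum_range_succ (fun i j => x i * y j)]
  have h : PowerSeries.mk (sProd (sProd a b) c) = PowerSeries.mk (sProd a (sProd b c)) := by
    simp only [key, mul_assoc]
  funext n
  have := congrArg (PowerSeries.coeff n) h
  simpa using this

lemma sProd_one_sub (x r : ℕ → Quaternion ℝ) (n : ℕ) :
    sProd x r n - r n = sProd (fun m => x m - oneS m) r n := by
  have h1 : r n = ∑ k ∈ Finset.range (n + 1), oneS k * r (n - k) := by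
    rw [Finset.sum_eq_single 0]
    · simp [oneS, constS]
    · intro b _ hb; simp [oneS, constS, hb]
    · simp
  conv_lhs => rw [h1]
  simp only [sProd, ← Finset.sum_sub_distrib, sub_mul]

lemma nnnorm_sq_sProd_le (g r : ℕ → Quaternion ℝ) (N : ℕ) (hr : IsPolyDeg r N) (n : ℕ) :
    ‖sProd g r n‖₊ ^ 2 ≤ (N + 1) * ∑ x ∈ Finset.HasAntidiagonal.antidiagonal n, ‖g x.1‖₊ ^ 2 * ‖r x.2‖₊ ^ 2 := by
  have h1 : sProd g r n = ∑ x ∈ (Finset.HasAntidiagonal.antidiagonal n).filter (fun x => x.2 ≤ N), g x.1 * r x.2 := by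
    simp only [sProd]
    rw [← Finset.Nat.sum_antidiagonal_eq_sum_range_succ (fun i j => g i * r j), Finset.sum_filter]
    refine Finset.sum_congr rfl fun x _ => ?_
    split_ifs with h
    · rfl
    · rw [hr _ (by omega), mul_zero]
  have hc : ((Finset.HasAntidiagonal.antidiagonal n).filter (fun x => x.2 ≤ N)).card ≤ N + 1 := by
    rw [← Finset.card_range (N + 1)]
    apply Finset.card_le_card_of_injOn (fun x => x.2)
    · intro x hx; simp at hx ⊢; omega
    · intro x hx y hy hxy
      simp at hx hy hxy
      ext <;> omega
  rw [h1]
  calc _ ≤ (∑ x ∈ (Finset.HasAntidiagonal.antidiagonal n).filter (fun x => x.2 ≤ N), ‖g x.1‖₊ * ‖r x.2‖₊) ^ 2 := by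
        gcongr
        refine (nnnorm_sum_le _ _).trans ?_
        simp
    _ ≤ _ := sq_sum_le_card_mul_sum_sq
    _ ≤ _ := by
        gcongr
        · exact_mod_cast hc
        · simp only [mul_pow]
          exact Finset.sum_le_sum_of_subset (Finset.filter_subset _ _)

lemma h2dist_mul (r : ℕ → Quaternion ℝ) (N : ℕ) (hr : IsPolyDeg r N) :
    ∃ C : ℝ≥0∞, C ≠ ⊤ ∧ ∀ x, h2distSq (sProd x r) r ≤ C * h2distSq x oneS := by
  refine ⟨(N + 1) * ∑' n, (‖r n‖₊ : ℝ≥0∞) ^ 2, ?_, fun x => ?_⟩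
  · apply ENNReal.mul_ne_top (by norm_cast; exact ENNReal.natCast_ne_top _)
    rw [tsum_eq_sum (s := Finset.range (N + 1))]
    · rw [ENNReal.sum_ne_top]
      intro i _
      exact ENNReal.pow_ne_top ENNReal.coe_ne_top
    · intro b hb
      rw [hr b (by simp at hb; omega)]; simp
  · unfold h2distSq
    simp only [sProd_one_sub]
    set g : ℕ → Quaternion ℝ := fun m => x m - oneS m with hg
    calc _ ≤ ∑' n, ((N:ℝ≥0∞) + 1) * ∑ y ∈ Finset.HasAntidiagonal.antidiagonal n,
            (‖g y.1‖₊ : ℝ≥0∞) ^ 2 * (‖r y.2‖₊ : ℝ≥0∞) ^ 2 := by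
          refine ENNReal.tsum_le_tsum fun n => ?_
          have := nnnorm_sq_sProd_le g r N hr n
          exact_mod_cast this
      _ = ((N:ℝ≥0∞) + 1) * ∑' y : ℕ × ℕ, (‖g y.1‖₊ : ℝ≥0∞) ^ 2 * (‖r y.2‖₊ : ℝ≥0∞) ^ 2 := by
          rw [ENNReal.tsum_mul_left]
          congr 1
          rw [← Finset.HasAntidiagonal.sigmaAntidiagonalEquivProd.tsum_eq, ENNReal.tsum_sigma']
          refine tsum_congr fun n => ?_
          rw [tsum_fintype]
          exact (Finset.sum_coe_sort (Finset.HasAntidiagonal.antidiagonal n) (fun y : ℕ × ℕ => (‖g y.1‖₊ : ℝ≥0∞) ^ 2 * (‖r y.2‖₊ : ℝ≥0∞) ^ 2)).symm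
      _ = _ := by
          rw [mul_assoc, ENNReal.tsum_prod (f := fun i j => (‖g i‖₊ : ℝ≥0∞) ^ 2 * (‖r j‖₊ : ℝ≥0∞) ^ 2)]
          simp only [ENNReal.tsum_mul_left, ENNReal.tsum_mul_right]
          rw [mul_comm (∑' n, (‖r n‖₊ : ℝ≥0∞) ^ 2)]

lemma h2dist_triangle (x y z : ℕ → Quaternion ℝ) :
    h2distSq x z ≤ 2 * (h2distSq x y + h2distSq y z) := by
  unfold h2distSq
  rw [← ENNReal.tsum_add, ← ENNReal.tsum_mul_left]
  refine ENNReal.tsum_le_tsum fun n => ?_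
  have : ‖x n - z n‖₊ ^ 2 ≤ 2 * (‖x n - y n‖₊ ^ 2 + ‖y n - z n‖₊ ^ 2) := by
    have h : ‖x n - z n‖ ≤ ‖x n - y n‖ + ‖y n - z n‖ := norm_sub_le_norm_sub_add_norm_sub _ _ _
    rw [← NNReal.coe_le_coe]
    push_cast
    nlinarith [norm_nonneg (x n - z n), sq_nonneg (‖x n - y n‖ - ‖y n - z n‖)]
  exact_mod_cast this

lemma h2dist_eq (x y : ℕ → Quaternion ℝ) (S : ℝ) (h : HasSum (fun n => ‖x n - y n‖ ^ 2) S) :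
    h2distSq x y = ENNReal.ofReal S := by
  unfold h2distSq
  rw [← h.tsum_eq, ENNReal.ofReal_tsum_of_nonneg (fun n => by positivity) h.summable]
  refine tsum_congr fun n => ?_
  rw [ENNReal.ofReal_pow (norm_nonneg _), ofReal_norm]
  rfl

lemma trunc_approx (h : ℕ → Quaternion ℝ) (hh : MemH2 h) (ε : ℝ≥0∞) (hε : 0 < ε) :
    ∃ N r, IsPolyDeg r N ∧ h2distSq r h < ε := by
  have hs : ∑' n, (‖h n‖₊ : ℝ≥0∞) ^ 2 ≠ ⊤ := by
    have h1 : Summable (fun n => ‖h n‖₊ ^ 2) := by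
      rw [← NNReal.summable_coe]; simpa [MemH2] using hh
    simpa using ENNReal.tsum_coe_ne_top_iff_summable.2 h1
  have ht := ENNReal.tendsto_sum_nat_add (fun n => (‖h n‖₊ : ℝ≥0∞) ^ 2) hs
  obtain ⟨N, hN⟩ := (ht.eventually_lt_const hε).exists
  refine ⟨N, fun n => if n < N then h n else 0, fun m hm => ?_, ?_⟩
  · simp; intro h; omega
  · refine lt_of_le_of_lt ?_ hN
    unfold h2distSq
    rw [← ENNReal.summable.sum_add_tsum_nat_add' (k := N), Finset.sum_eq_zero, zero_add]
    · refine ENNReal.tsum_le_tsum fun n => ?_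
      simp
    · intro n hn; simp at hn; simp [hn]

lemma cyclic_of_one (a : ℕ → Quaternion ℝ) (ha : MemH2 a)
    (h : ∀ ε : ℝ≥0∞, 0 < ε → ∃ p, IsPolyQ p ∧ h2distSq (sProd a p) oneS < ε) : IsCyclicQ a := by
  refine ⟨ha, fun g hg => ⟨hg, fun ε hε => ?_⟩⟩
  wlog hεt : ε ≠ ⊤ generalizing ε
  · obtain ⟨p, hp, hp'⟩ := this 1 one_pos ENNReal.one_ne_top
    push Not at hεt
    exact ⟨p, hp, by rw [hεt]; exact hp'.trans ENNReal.one_lt_top⟩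
  have h4 : 0 < ε / 4 := ENNReal.div_pos hε.ne' (by simp)
  obtain ⟨N, r, hr, hrg⟩ := trunc_approx g hg (ε / 4) h4
  obtain ⟨C, hC, hCx⟩ := h2dist_mul r N hr
  have hd : 0 < ε / 4 / (C + 1) := ENNReal.div_pos h4.ne' (by simp [hC])
  obtain ⟨p, ⟨M, hM⟩, hp⟩ := h _ hd
  refine ⟨sProd p r, ⟨M + N, fun n hn => ?_⟩, ?_⟩
  · unfold sProd
    refine Finset.sum_eq_zero fun k hk => ?_
    by_cases hkM : k > M
    · rw [hM k hkM, zero_mul]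
    · rw [hr (n - k) (by omega), mul_zero]
  · have h1 : h2distSq (sProd a (sProd p r)) r ≤ ε / 4 := by
      rw [← sProd_assoc]
      calc _ ≤ _ := hCx _
        _ ≤ (C + 1) * (ε / 4 / (C + 1)) := by gcongr; exact le_self_add
        _ ≤ ε / 4 := ENNReal.mul_div_le
    calc _ ≤ _ := h2dist_triangle _ r _
      _ < 2 * (ε / 4 + ε / 4) := by
          apply ENNReal.mul_lt_mul_right (by simp) (by simp)
          exact ENNReal.add_lt_add_of_le_of_lt (ne_top_of_le_ne_top (ENNReal.div_ne_top hεt (by simp)) h1) h1 hrg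
      _ = ε := by
          have : (4:ℝ≥0∞) = 2 * 2 := by norm_num
          rw [two_mul, ← two_mul, ← two_mul, ← mul_assoc, ← this]
          exact ENNReal.mul_div_cancel (by simp) (by simp)

lemma ortho_hasSum (F : ℕ → ℕ → Quaternion ℝ)
    (horth : ∀ j k : ℕ, h2inner (F j) (F k) = if j = k then 1 else 0) (j k : ℕ) :
    HasSum (fun m => star (F k m) * F j m) (if j = k then 1 else 0) := by
  have hmem : ∀ k, Summable (fun m => ‖F k m‖ ^ 2) := by
    intro k
    have h1 := horth k k
    rw [if_pos rfl, h2inner] at h1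
    have h2 : Summable (fun m => star (F k m) * F k m) := by
      by_contra hn
      rw [tsum_eq_zero_of_not_summable hn] at h1
      exact zero_ne_one h1
    have h3 := h2.norm
    refine h3.congr fun m => ?_
    simp [sq]
  have hs : Summable (fun m => star (F k m) * F j m) := by
    refine Summable.of_norm_bounded ((hmem k).add (hmem j)) fun m => ?_
    simp only [norm_mul, norm_star]
    nlinarith [sq_nonneg (‖F k m‖ - ‖F j m‖), sq_nonneg (‖F k m‖), sq_nonneg (‖F j m‖)]
  rw [← horth j k]
  exact hs.hasSum

lemma normSq_hasSum (F : ℕ → ℕ → Quaternion ℝ)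
    (horth : ∀ j k : ℕ, h2inner (F j) (F k) = if j = k then 1 else 0)
    (s : Finset ℕ) (d : ℕ → Quaternion ℝ) :
    HasSum (fun m => ‖∑ k ∈ s, F k m * d k‖ ^ 2) (∑ k ∈ s, ‖d k‖ ^ 2) := by
  have h1 : HasSum (fun m => ∑ k ∈ s, ∑ j ∈ s, star (d k) * (star (F k m) * F j m) * d j)
      (∑ k ∈ s, ∑ j ∈ s, star (d k) * (if j = k then 1 else 0) * d j) :=
    hasSum_sum fun k _ => hasSum_sum fun j _ =>
      ((ortho_hasSum F horth j k).mul_left _).mul_right _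
  rw [← Quaternion.hasSum_coe]
  have hn : ∀ x : Quaternion ℝ, ((‖x‖ ^ 2 : ℝ) : Quaternion ℝ) = star x * x := by
    intro x
    rw [Quaternion.star_mul_self, Quaternion.normSq_eq_norm_mul_self, sq]
  have hc : ((∑ k ∈ s, ‖d k‖ ^ 2 : ℝ) : Quaternion ℝ)
      = ∑ k ∈ s, ((‖d k‖ ^ 2 : ℝ) : Quaternion ℝ) :=
    map_sum (algebraMap ℝ (Quaternion ℝ)) _ _
  rw [hc]
  simp only [hn]
  convert h1 using 1
  · funext m
    rw [star_sum, Finset.sum_mul_sum]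
    simp only [star_mul, mul_assoc]
  · refine Finset.sum_congr rfl fun k hk => ?_
    simp [hk]

lemma dist_one_hasSum (F : ℕ → ℕ → Quaternion ℝ)
    (horth : ∀ j k : ℕ, h2inner (F j) (F k) = if j = k then 1 else 0)
    (s : Finset ℕ) (d : ℕ → Quaternion ℝ) :
    HasSum (fun m => ‖(∑ k ∈ s, F k m * d k) - oneS m‖ ^ 2)
      (1 - ∑ k ∈ s, ‖star (F k 0)‖ ^ 2 + ∑ k ∈ s, ‖d k - star (F k 0)‖ ^ 2) := by
  have h1 := normSq_hasSum F horth s d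
  have h2 : HasSum (fun m => if m = 0 then 1 - 2 * (∑ k ∈ s, F k 0 * d k).re else 0)
    (1 - 2 * (∑ k ∈ s, F k 0 * d k).re) := hasSum_ite_eq 0 _
  have key : ∀ x y : Quaternion ℝ, ‖x - star y‖ ^ 2 = ‖x‖ ^ 2 + ‖star y‖ ^ 2 - 2 * (y * x).re := by
    intro x y
    simp only [sq, ← Quaternion.normSq_eq_norm_mul_self, Quaternion.normSq_def']
    simp
    ring
  convert h1.add h2 using 1
  · funext m
    by_cases hm : m = 0
    · subst hm
      have := key (∑ k ∈ s, F k 0 * d k) 1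
      simp at this
      simp [oneS, constS, this]; ring
    · simp [hm, oneS, constS]
  · have : (∑ k ∈ s, F k 0 * d k).re = ∑ k ∈ s, (F k 0 * d k).re :=
      map_sum (show Quaternion ℝ →ₗ[ℝ] ℝ from QuaternionAlgebra.reₗ _ _ _) _ _
    rw [this]
    simp only [key, Finset.sum_sub_distrib, Finset.sum_add_distrib, ← Finset.mul_sum]
    ring

/-- Let `f ∈ H²(𝔹)` with `f(0) ≠ 0`, let `p_n` be the optimal approximant of degree `n`
of `f^{-*}` for each `n`, and let `{f * φ_k}` be an orthonormal system such that
`{f * φ_k}_{k=0}^n` is an orthonormal basis of `f * 𝒫_n` with `deg φ_k = k`. TFAE: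
(i) `f` is cyclic; (ii) `p_n(0) → f^{-*}(0)`; (iii) `∑_k |φ_k(0)|² = |f^{-*}(0)|²`. -/
theorem cyclic_iff_opt_approx_converge (a : ℕ → Quaternion ℝ) (ha : MemH2 a)
    (h0 : evalS a 0 ≠ 0) (p : ℕ → ℕ → Quaternion ℝ)
    (hp : ∀ n, IsOptApprox a n (p n))
    (φ : ℕ → ℕ → Quaternion ℝ) (hdeg : ∀ k, IsPolyDeg (φ k) k)
    (horth : ∀ j k : ℕ, h2inner (sProd a (φ j)) (sProd a (φ k)) = if j = k then 1 else 0)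
    (hspan : ∀ n, ∀ r, IsPolyDeg r n → ∃ c : ℕ → Quaternion ℝ,
      sProd a r = fun m => ∑ k ∈ Finset.range (n + 1), sProd a (φ k) m * c k) :
    [ IsCyclicQ a,
      Tendsto (fun n => evalS (p n) 0) atTop
        (𝓝 ((evalS (symmS a) 0)⁻¹ * evalS (conjS a) 0)),
      (∑' k : ℕ, ‖evalS (φ k) 0‖ ^ 2) =
        ‖(evalS (symmS a) 0)⁻¹ * evalS (conjS a) 0‖ ^ 2 ].TFAE := by
  rw [target_eq]
  simp only [evalS_zero'] at h0 ⊢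
  set F : ℕ → ℕ → Quaternion ℝ := fun k => sProd a (φ k) with hF
  have hF0 : ∀ k, F k 0 = a 0 * φ k 0 := fun k => by simp [hF, sProd]
  set T : ℕ → ℝ := fun n => ∑ k ∈ Finset.range (n + 1), ‖star (F k 0)‖ ^ 2 with hT
  have hTle : ∀ n, T n ≤ 1 := by
    intro n
    have h := dist_one_hasSum F horth (Finset.range (n + 1)) (fun k => star (F k 0))
    have h' := h.nonneg (fun m => by positivity)
    simp only [sub_self, norm_zero] at h'
    simp at h'
    simpa [hT] using h'
  have hopt : ∀ n, sProd a (p n) = fun m => ∑ k ∈ Finset.range (n + 1), F k m * star (F k 0) := by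
    intro n
    obtain ⟨d, hd⟩ := hspan n (p n) (hp n).1
    set r : ℕ → Quaternion ℝ := fun m => ∑ k ∈ Finset.range (n + 1), φ k m * star (F k 0) with hr
    have hrdeg : IsPolyDeg r n := by
      intro m hm
      refine Finset.sum_eq_zero fun k hk => ?_
      have hk' : k < n + 1 := Finset.mem_range.1 hk
      rw [hdeg k m (by omega), zero_mul]
    have hr' : sProd a r = fun m => ∑ k ∈ Finset.range (n + 1), F k m * star (F k 0) := by
      funext m
      simp only [sProd, hr, hF, Finset.mul_sum, Finset.sum_mul, ← mul_assoc]
      rw [Finset.sum_comm]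
    have h1 := (hp n).2 r hrdeg
    rw [hd, hr', h2dist_eq _ _ _ (dist_one_hasSum F horth _ d),
      h2dist_eq _ _ _ (dist_one_hasSum F horth _ _)] at h1
    simp only [sub_self, norm_zero] at h1
    rw [ENNReal.ofReal_le_ofReal_iff (by have := hTle n; simp [hT] at this; simpa using this)] at h1
    have h2 : ∑ k ∈ Finset.range (n + 1), ‖d k - star (F k 0)‖ ^ 2 ≤ 0 := by
      simp at h1; simpa using h1
    have h3 := (Finset.sum_eq_zero_iff_of_nonneg (fun k _ => by positivity)).1
      (le_antisymm h2 (Finset.sum_nonneg fun k _ => by positivity))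
    rw [hd]
    funext m
    refine Finset.sum_congr rfl fun k hk => ?_
    have h4 := h3 k hk
    have : d k = star (F k 0) := by simpa [sub_eq_zero] using h4
    rw [this]
  have hdist : ∀ n, h2distSq (sProd a (p n)) oneS = ENNReal.ofReal (1 - T n) := by
    intro n
    rw [hopt n, h2dist_eq _ _ _ (dist_one_hasSum F horth _ _)]
    simp [hT]
  have hp0 : ∀ n, a 0 * p n 0 = ((T n : ℝ) : Quaternion ℝ) := by
    intro n
    have h1 : sProd a (p n) 0 = a 0 * p n 0 := by simp [sProd]
    rw [← h1, hopt n]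
    simp only [hT, Quaternion.self_mul_star, Quaternion.normSq_eq_norm_mul_self, norm_star, sq]
    exact (map_sum (algebraMap ℝ (Quaternion ℝ)) _ _).symm
  have hsq : ∀ k, ‖star (F k 0)‖ ^ 2 = ‖a 0‖ ^ 2 * ‖φ k 0‖ ^ 2 := by
    intro k; rw [norm_star, hF0, norm_mul, mul_pow]
  have hna : ‖a 0‖ ^ 2 ≠ 0 := by simpa using h0
  have hTlim : Tendsto T atTop (𝓝 1) ↔ HasSum (fun k => ‖star (F k 0)‖ ^ 2) 1 := by
    rw [hasSum_iff_tendsto_nat_of_nonneg (fun k => by positivity)]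
    exact tendsto_add_atTop_iff_nat (f := fun n => ∑ k ∈ Finset.range n, ‖star (F k 0)‖ ^ 2) 1
  tfae_have 1 → 2 := by
    intro hc
    have hone : MemH2 oneS := by
      refine summable_of_ne_finset_zero (s := {0}) fun n hn => ?_
      have : n ≠ 0 := by simpa using hn
      simp [oneS, constS, this]
    have hlim : Tendsto T atTop (𝓝 1) := by
      rw [Metric.tendsto_atTop]
      intro ε hε
      obtain ⟨r, ⟨N, hN⟩, hr⟩ := (hc.2 oneS hone).2 (ENNReal.ofReal ε) (by simpa using hε)
      refine ⟨N, fun n hn => ?_⟩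
      have h1 := ((hp n).2 r (fun m hm => hN m (by omega))).trans_lt hr
      rw [hdist, ENNReal.ofReal_lt_ofReal_iff hε] at h1
      rw [Real.dist_eq, abs_lt]
      constructor <;> linarith [hTle n]
    have h2 : (fun n => p n 0) = fun n => (a 0)⁻¹ * ((T n : ℝ) : Quaternion ℝ) := by
      funext n
      rw [← hp0, ← mul_assoc, inv_mul_cancel₀ h0, one_mul]
    rw [h2]
    have h3 := ((Quaternion.continuous_coe.tendsto 1).comp hlim).const_mul (a 0)⁻¹
    simpa using h3
  tfae_have 2 → 3 := by
    intro h
    have h1 : Tendsto T atTop (𝓝 1) := by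
      have h2 := (Quaternion.continuous_re.tendsto _).comp (h.const_mul (a 0))
      simp only [Function.comp_def, hp0, mul_inv_cancel₀ h0, Quaternion.re_coe,
        Quaternion.re_one] at h2
      exact h2
    have h2 := (hTlim.1 h1).tsum_eq
    simp only [hsq, tsum_mul_left] at h2
    rw [norm_inv, inv_pow]
    exact eq_inv_of_mul_eq_one_right h2
  tfae_have 3 → 1 := by
    intro h
    have hs : Summable (fun k => ‖star (F k 0)‖ ^ 2) := by
      simp only [hsq]
      apply Summable.mul_left
      by_contra hn
      rw [tsum_eq_zero_of_not_summable hn, norm_inv, inv_pow] at h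
      exact inv_ne_zero hna h.symm
    have h1 : HasSum (fun k => ‖star (F k 0)‖ ^ 2) 1 := by
      have h2 := hs.hasSum
      have h3 : ∑' k, ‖star (F k 0)‖ ^ 2 = 1 := by
        simp only [hsq, tsum_mul_left]
        rw [h, norm_inv, inv_pow, mul_inv_cancel₀ hna]
      rwa [h3] at h2
    have hlim := hTlim.2 h1
    refine cyclic_of_one a ha fun ε hε => ?_
    have h4 : Tendsto (fun n => ENNReal.ofReal (1 - T n)) atTop (𝓝 0) := by
      have := ENNReal.tendsto_ofReal (hlim.const_sub 1)
      simpa using this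
    obtain ⟨n, hn⟩ := (h4.eventually_lt_const hε).exists
    exact ⟨p n, ⟨n, (hp n).1⟩, by rw [hdist]; exact hn⟩
  tfae_finish
end
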